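/- For any smooth function U : ℝ × ℝ → ℝ (not necessarily a solution), the identity D_x( U³ + U² U_{xxxx} − (2/3)U U_{xt} + (1/3)U_x U_t − U² U_{xx} + (4/5)U U_{xxxt} − (1/5)U_{xxx} U_t − (3/5)U_x U_{xxt} + (2/5)U_{xx} U_{xt} ) + D_t( (1/2)U² − (1/3)U U_{xx} + (1/6)U_x² + (1/5)U U_{xxxx} − (1/5)U_x U_{xxx} + (1/10)U_{xx}² ) = U · ( U_t − U_{xxt} + U_{xxxxt} + 3 U U_x − 2 U_x U_{xx} − U U_{xxx} + 2 U_x U_{xxxx} + U U_{xxxxx} ) holds pointwise. -/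

import Mathlib

/-- Partial derivative in the first (space) variable `x`. -/
noncomputable def pdx (u : ℝ × ℝ → ℝ) : ℝ × ℝ → ℝ :=
  fun p => deriv (fun x => u (x, p.2)) p.1

/-- Partial derivative in the second (time) variable `t`. -/
noncomputable def pdt (u : ℝ × ℝ → ℝ) : ℝ × ℝ → ℝ :=
  fun p => deriv (fun t => u (p.1, t)) p.2

/-- The higher order Camassa–Holm operator
`Δ[u] = u_t − u_{xxt} + u_{xxxxt} + 3uu_x − 2u_xu_{xx} − uu_{xxx} + 2u_xu_{xxxx} + uu_{xxxxx}`. -/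
noncomputable def CH (u : ℝ × ℝ → ℝ) : ℝ × ℝ → ℝ := fun p =>
  pdt u p - pdx (pdx (pdt u)) p + pdx (pdx (pdx (pdx (pdt u)))) p
    + 3 * u p * pdx u p - 2 * pdx u p * pdx (pdx u) p
    - u p * pdx (pdx (pdx u)) p
    + 2 * pdx u p * pdx (pdx (pdx (pdx u))) p
    + u p * pdx (pdx (pdx (pdx (pdx u)))) p

/-- Flux `Φ` of the conservation law with multiplier `Λ = u`. -/
noncomputable def Phi2 (u : ℝ × ℝ → ℝ) : ℝ × ℝ → ℝ := fun q =>
  (u q)^3 + (u q)^2 * pdx (pdx (pdx (pdx u))) q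
    - (2/3) * u q * pdx (pdt u) q + (1/3) * pdx u q * pdt u q
    - (u q)^2 * pdx (pdx u) q + (4/5) * u q * pdx (pdx (pdx (pdt u))) q
    - (1/5) * pdx (pdx (pdx u)) q * pdt u q
    - (3/5) * pdx u q * pdx (pdx (pdt u)) q
    + (2/5) * pdx (pdx u) q * pdx (pdt u) q

/-- Density `Ψ` of the conservation law with multiplier `Λ = u`. -/
noncomputable def Psi2 (u : ℝ × ℝ → ℝ) : ℝ × ℝ → ℝ := fun q =>
  (1/2) * (u q)^2 - (1/3) * u q * pdx (pdx u) q + (1/6) * (pdx u q)^2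
    + (1/5) * u q * pdx (pdx (pdx (pdx u))) q
    - (1/5) * pdx u q * pdx (pdx (pdx u)) q
    + (1/10) * (pdx (pdx u) q)^2

lemma aux_hx {f : ℝ × ℝ → ℝ} (hf : ContDiff ℝ (⊤ : ℕ∞) f) (p : ℝ × ℝ) :
    HasDerivAt (fun x => f (x, p.2)) (fderiv ℝ f p (1, 0)) p.1 := by
  have h1 : HasFDerivAt f (fderiv ℝ f p) (p.1, p.2) :=
    (hf.differentiable (by simp) p).hasFDerivAt
  exact h1.comp_hasDerivAt p.1 ((hasDerivAt_id p.1).prodMk (hasDerivAt_const p.1 p.2))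

lemma aux_ht {f : ℝ × ℝ → ℝ} (hf : ContDiff ℝ (⊤ : ℕ∞) f) (p : ℝ × ℝ) :
    HasDerivAt (fun t => f (p.1, t)) (fderiv ℝ f p (0, 1)) p.2 := by
  have h1 : HasFDerivAt f (fderiv ℝ f p) (p.1, p.2) :=
    (hf.differentiable (by simp) p).hasFDerivAt
  exact h1.comp_hasDerivAt p.2 ((hasDerivAt_const p.2 p.1).prodMk (hasDerivAt_id p.2))

lemma pdx_eq {f : ℝ × ℝ → ℝ} (hf : ContDiff ℝ (⊤ : ℕ∞) f) :
    pdx f = fun p => fderiv ℝ f p (1, 0) := funext fun p => (aux_hx hf p).deriv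

lemma pdt_eq {f : ℝ × ℝ → ℝ} (hf : ContDiff ℝ (⊤ : ℕ∞) f) :
    pdt f = fun p => fderiv ℝ f p (0, 1) := funext fun p => (aux_ht hf p).deriv

lemma fd_smooth {f : ℝ × ℝ → ℝ} (hf : ContDiff ℝ (⊤ : ℕ∞) f) :
    ContDiff ℝ (⊤ : ℕ∞) (fderiv ℝ f) := hf.fderiv_right (by simp)

lemma pdx_smooth {f : ℝ × ℝ → ℝ} (hf : ContDiff ℝ (⊤ : ℕ∞) f) :
    ContDiff ℝ (⊤ : ℕ∞) (pdx f) := by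
  rw [pdx_eq hf]; exact (fd_smooth hf).clm_apply contDiff_const

lemma pdt_smooth {f : ℝ × ℝ → ℝ} (hf : ContDiff ℝ (⊤ : ℕ∞) f) :
    ContDiff ℝ (⊤ : ℕ∞) (pdt f) := by
  rw [pdt_eq hf]; exact (fd_smooth hf).clm_apply contDiff_const

lemma pd_comm {f : ℝ × ℝ → ℝ} (hf : ContDiff ℝ (⊤ : ℕ∞) f) :
    pdt (pdx f) = pdx (pdt f) := by
  rw [pdt_eq (pdx_smooth hf), pdx_eq (pdt_smooth hf), pdx_eq hf, pdt_eq hf]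
  funext p
  have hd : DifferentiableAt ℝ (fderiv ℝ f) p := (fd_smooth hf).differentiable (by simp) p
  have key : ∀ v w : ℝ × ℝ, fderiv ℝ (fun q => fderiv ℝ f q v) p w
      = fderiv ℝ (fderiv ℝ f) p w v := by
    intro v w
    rw [fderiv_clm_apply hd (differentiableAt_const v)]
    simp
  rw [key, key]
  have hs : IsSymmSndFDerivAt ℝ f p :=
    hf.contDiffAt.isSymmSndFDerivAt (by simp; exact WithTop.coe_le_coe.2 (le_top : (2 : ℕ∞) ≤ ⊤))
  exact hs _ _

lemma hX {f : ℝ × ℝ → ℝ} (hf : ContDiff ℝ (⊤ : ℕ∞) f) (p : ℝ × ℝ) :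
    HasDerivAt (fun x => f (x, p.2)) (pdx f p) p.1 :=
  (aux_hx hf p).differentiableAt.hasDerivAt

lemma hT {f : ℝ × ℝ → ℝ} (hf : ContDiff ℝ (⊤ : ℕ∞) f) (p : ℝ × ℝ) :
    HasDerivAt (fun t => f (p.1, t)) (pdt f p) p.2 :=
  (aux_ht hf p).differentiableAt.hasDerivAt

/-- Off-shell characteristic identity for the multiplier `Λ = U`:
`D_x Φ + D_t Ψ = U·Δ[U]` for every smooth `U`. -/
theorem CH_characteristic_identity_multiplier_u (U : ℝ × ℝ → ℝ) (hU : ContDiff ℝ (⊤ : ℕ∞) U) :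
    ∀ p : ℝ × ℝ, pdx (Phi2 U) p + pdt (Psi2 U) p = U p * CH U p := by
  intro p
  have s1 := pdx_smooth hU
  have s2 := pdx_smooth s1
  have s3 := pdx_smooth s2
  have s4 := pdx_smooth s3
  have r0 := pdt_smooth hU
  have r1 := pdx_smooth r0
  have r2 := pdx_smooth r1
  have r3 := pdx_smooth r2
  have c1 := pd_comm hU
  have c2 : pdt (pdx (pdx U)) = pdx (pdx (pdt U)) := by rw [pd_comm s1, c1]
  have c3 : pdt (pdx (pdx (pdx U))) = pdx (pdx (pdx (pdt U))) := by rw [pd_comm s2, c2]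
  have c4 : pdt (pdx (pdx (pdx (pdx U)))) = pdx (pdx (pdx (pdx (pdt U)))) := by
    rw [pd_comm s3, c3]
  have x0 := hX hU p
  have x1 := hX s1 p
  have x2 := hX s2 p
  have x3 := hX s3 p
  have x4 := hX s4 p
  have y0 := hX r0 p
  have y1 := hX r1 p
  have y2 := hX r2 p
  have y3 := hX r3 p
  have t0 := hT hU p
  have t1 := hT s1 p
  have t2 := hT s2 p
  have t3 := hT s3 p
  have t4 := hT s4 p
  rw [c1] at t1
  rw [c2] at t2
  rw [c3] at t3
  rw [c4] at t4
  have hPhi := (((((((((x0.pow 3).add ((x0.pow 2).mul x4)).sub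
    ((x0.const_mul (2/3)).mul y1)).add ((x1.const_mul (1/3)).mul y0)).sub
    ((x0.pow 2).mul x2)).add ((x0.const_mul (4/5)).mul y3)).sub
    ((x3.const_mul (1/5)).mul y0)).sub ((x1.const_mul (3/5)).mul y2)).add
    ((x2.const_mul (2/5)).mul y1))
  have hPsi := (((((((t0.pow 2).const_mul (1/2)).sub ((t0.const_mul (1/3)).mul t2)).add
    ((t1.pow 2).const_mul (1/6))).add ((t0.const_mul (1/5)).mul t4)).sub
    ((t1.const_mul (1/5)).mul t3)).add ((t2.pow 2).const_mul (1/10)))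
  have e1 : pdx (Phi2 U) p = _ := hPhi.deriv
  have e2 : pdt (Psi2 U) p = _ := hPsi.deriv
  rw [e1, e2]
  simp only [CH, Prod.mk.eta, Pi.pow_apply, Pi.mul_apply]
  push_cast
  ring
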